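/- arXiv:1602.05776 — 7 statements merged into one kernel-verified Lean document; each statement's English description precedes it below -/
import Mathlib

section
/- Let A and B be disjoint finite sets of primes with A ∪ B ≠ ∅, and let (n,m) be a pair of integers that is admissible with respect to (A,B). Then the finite abelian groups H₁ = ZMod n_A × ZMod n_C × ZMod m_B × ZMod m_D and H₂ = ZMod (n_A/m_A) × ZMod n_B × ZMod n_C × ZMod m_A × ZMod (m_B/n_B) × ZMod m_D are not isomorphic as groups. -/
/-- `primePart n P` is the `P`-part of `n`: the largest divisor of `n` all of whose
prime factors lie in `P`, i.e. `∏_{p ∈ P} p ^ (v_p n)`. -/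
def primePart (n : ℕ) (P : Finset ℕ) : ℕ :=
  ∏ p ∈ n.primeFactors ∩ P, p ^ (n.factorization p)

/-- The pair `(n, m)` is admissible with respect to the pair `(A, B)` of disjoint finite
sets of primes with `A ∪ B ≠ ∅`: one requires `A ∪ B ⊆ Π(n) ∩ Π(m)`, that `m_A ∣ n_A`,
`n_B ∣ m_B`, and that the integer `(n_A · m_B) / (m_A · n_B)` is strictly greater than `1`. -/
def Admissible (A B : Finset ℕ) (n m : ℕ) : Prop :=
  (∀ p ∈ A, p.Prime) ∧ (∀ p ∈ B, p.Prime) ∧ Disjoint A B ∧ (A ∪ B).Nonempty ∧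
  2 ≤ n ∧ 2 ≤ m ∧
  A ∪ B ⊆ n.primeFactors ∩ m.primeFactors ∧
  primePart m A ∣ primePart n A ∧
  primePart n B ∣ primePart m B ∧
  1 < primePart n A * primePart m B / (primePart m A * primePart n B)

theorem primePart_ne_zero (n : ℕ) (P : Finset ℕ) : primePart n P ≠ 0 :=
  Finset.prod_ne_zero_iff.2 fun _ hp =>
    pow_ne_zero _ (Nat.prime_of_mem_primeFactors (Finset.mem_inter.1 hp).1).ne_zero

theorem Nat.Prime.dvd_primePart_iff {p : ℕ} (hp : p.Prime) (n : ℕ) (P : Finset ℕ) :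
    p ∣ primePart n P ↔ p ∈ n.primeFactors ∧ p ∈ P := by
  rw [primePart, hp.prime.dvd_finsetProd_iff]
  constructor
  · rintro ⟨q, hq, hpq⟩
    have hq' := Finset.mem_inter.1 hq
    rw [(Nat.prime_dvd_prime_iff_eq hp (Nat.prime_of_mem_primeFactors hq'.1)).1
      (hp.dvd_of_dvd_pow hpq)]
    exact hq'
  · intro h
    have hn := Nat.mem_primeFactors.1 h.1
    exact ⟨p, Finset.mem_inter.2 h,
      dvd_pow_self p (hp.factorization_pos_of_dvd hn.2.2 hn.2.1).ne'⟩

/-- The number of elements of `G` annihilated by `d`. -/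
noncomputable def torsionCard (d : ℕ) (G : Type*) [AddCommGroup G] : ℕ :=
  Nat.card {x : G // d • x = 0}

theorem torsionCard_congr (d : ℕ) {G H : Type*} [AddCommGroup G] [AddCommGroup H] (e : G ≃+ H) :
    torsionCard d G = torsionCard d H :=
  Nat.card_congr <| e.toEquiv.subtypeEquiv fun x => by
    rw [← e.map_eq_zero_iff, map_nsmul]; rfl

theorem torsionCard_prod (d : ℕ) (G H : Type*) [AddCommGroup G] [AddCommGroup H] :
    torsionCard d (G × H) = torsionCard d G * torsionCard d H := by
  simp only [torsionCard]
  rw [← Nat.card_prod]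
  exact Nat.card_congr <|
    (Equiv.subtypeEquivRight fun x => by simp [Prod.ext_iff]).trans
      (Equiv.subtypeProdEquivProd (p := fun x : G => d • x = 0) (q := fun y : H => d • y = 0))

theorem torsionCard_zmod (d : ℕ) {N : ℕ} (hN : N ≠ 0) : torsionCard d (ZMod N) = N.gcd d := by
  have : NeZero N := ⟨hN⟩
  have h := IsAddCyclic.card_nsmulAddMonoidHom_ker (G := ZMod N) d
  rw [Nat.card_zmod] at h
  exact h

theorem Nat.Prime.gcd_eq_one_of_not_dvd {p N : ℕ} (hp : p.Prime) (h : ¬ p ∣ N) : N.gcd p = 1 :=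
  ((hp.coprime_iff_not_dvd).2 h).symm

/-- The groups `H₁ = ZMod n_A × ZMod n_C × ZMod m_B × ZMod m_D` and
`H₂ = ZMod (n_A/m_A) × ZMod n_B × ZMod n_C × ZMod m_A × ZMod (m_B/n_B) × ZMod m_D`
are not isomorphic. -/
theorem not_isomorphic_H1_H2 (A B : Finset ℕ) (n m : ℕ) (h : Admissible A B n m) :
    ¬ Nonempty
      ((ZMod (primePart n A) × ZMod (primePart n (n.primeFactors \ (A ∪ B))) ×
          ZMod (primePart m B) × ZMod (primePart m (m.primeFactors \ (A ∪ B)))) ≃+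
        (ZMod (primePart n A / primePart m A) × ZMod (primePart n B) ×
          ZMod (primePart n (n.primeFactors \ (A ∪ B))) × ZMod (primePart m A) ×
          ZMod (primePart m B / primePart n B) ×
          ZMod (primePart m (m.primeFactors \ (A ∪ B))))) := by
  obtain ⟨-, -, hAB, -, -, -, hsub, hA, hB, hlt⟩ := h
  rintro ⟨e⟩
  have hA0 : primePart n A / primePart m A ≠ 0 :=
    (Nat.div_pos (Nat.le_of_dvd (Nat.pos_of_ne_zero (primePart_ne_zero _ _)) hA)
      (Nat.pos_of_ne_zero (primePart_ne_zero _ _))).ne'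
  have hB0 : primePart m B / primePart n B ≠ 0 :=
    (Nat.div_pos (Nat.le_of_dvd (Nat.pos_of_ne_zero (primePart_ne_zero _ _)) hB)
      (Nat.pos_of_ne_zero (primePart_ne_zero _ _))).ne'
  rw [← Nat.div_mul_div_comm hA hB] at hlt
  obtain ⟨p, hp, hdvd⟩ := Nat.exists_prime_and_dvd hlt.ne'
  have hcard := torsionCard_congr p e
  simp only [torsionCard_prod, torsionCard_zmod p (primePart_ne_zero _ _),
    torsionCard_zmod p hA0, torsionCard_zmod p hB0] at hcard
  have hpAB : p ∈ A ∪ B := by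
    rcases hp.dvd_mul.1 hdvd with hd | hd
    · exact Finset.mem_union_left _
        ((hp.dvd_primePart_iff _ _).1 (hd.trans (Nat.div_dvd_of_dvd hA))).2
    · exact Finset.mem_union_right _
        ((hp.dvd_primePart_iff _ _).1 (hd.trans (Nat.div_dvd_of_dvd hB))).2
  obtain ⟨hpn, hpm⟩ := Finset.mem_inter.1 (hsub hpAB)
  have hgcd_compl (k : ℕ) : (primePart k (k.primeFactors \ (A ∪ B))).gcd p = 1 :=
    hp.gcd_eq_one_of_not_dvd fun h =>
      (Finset.mem_sdiff.1 ((hp.dvd_primePart_iff _ _).1 h).2).2 hpAB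
  have hgcd_mem {k : ℕ} {P : Finset ℕ} (hk : p ∈ k.primeFactors) (hP : p ∈ P) :
      (primePart k P).gcd p = p :=
    Nat.gcd_eq_right ((hp.dvd_primePart_iff _ _).2 ⟨hk, hP⟩)
  have hgcd_notMem (k : ℕ) {P : Finset ℕ} (hP : p ∉ P) : (primePart k P).gcd p = 1 :=
    hp.gcd_eq_one_of_not_dvd fun h => hP ((hp.dvd_primePart_iff _ _).1 h).2
  have key (a : ℕ) (ha : 0 < a) : p ≠ p * p * a := fun h => by
    nlinarith [hp.two_le, Nat.mul_le_mul_left (p * p) ha]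
  have hposA : 0 < (primePart n A / primePart m A).gcd p := Nat.gcd_pos_of_pos_right _ hp.pos
  have hposB : 0 < (primePart m B / primePart n B).gcd p := Nat.gcd_pos_of_pos_right _ hp.pos
  rcases hp.dvd_mul.1 hdvd with hd | hd
  · have hpA : p ∈ A :=
      ((hp.dvd_primePart_iff _ _).1 (hd.trans (Nat.div_dvd_of_dvd hA))).2
    have hpB : p ∉ B := Finset.disjoint_left.1 hAB hpA
    rw [hgcd_compl, hgcd_compl, hgcd_mem hpn hpA, hgcd_mem hpm hpA, hgcd_notMem n hpB,
      hgcd_notMem m hpB, Nat.gcd_eq_right hd] at hcard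
    exact key _ hposB (by linarith)
  · have hpB : p ∈ B :=
      ((hp.dvd_primePart_iff _ _).1 (hd.trans (Nat.div_dvd_of_dvd hB))).2
    have hpA : p ∉ A := Finset.disjoint_right.1 hAB hpB
    rw [hgcd_compl, hgcd_compl, hgcd_mem hpn hpB, hgcd_mem hpm hpB, hgcd_notMem n hpA,
      hgcd_notMem m hpA, Nat.gcd_eq_right hd] at hcard
    exact key _ hposA (by linarith)
end

section
/- Let A and B be disjoint finite sets of primes with A ∪ B ≠ ∅, and let (n,m) be admissible with respect to (A,B). Then there exists a prime p ∈ A ∪ B such that every Sylow p-subgroup of H₁ = ZMod n_A × ZMod n_C × ZMod m_B × ZMod m_D is cyclic, while no Sylow p-subgroup of H₂ = ZMod (n_A/m_A) × ZMod n_B × ZMod n_C × ZMod m_A × ZMod (m_B/n_B) × ZMod m_D is cyclic. -/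
theorem primePart_pos (n : ℕ) (P : Finset ℕ) : 0 < primePart n P :=
  Finset.prod_pos fun _ hq =>
    pow_pos (Nat.prime_of_mem_primeFactors (Finset.mem_inter.1 hq).1).pos _

instance primePart_neZero (n : ℕ) (P : Finset ℕ) : NeZero (primePart n P) :=
  ⟨(primePart_pos n P).ne'⟩

theorem mem_of_prime_dvd_primePart {n p : ℕ} {P : Finset ℕ} (hp : p.Prime)
    (h : p ∣ primePart n P) : p ∈ P := by
  obtain ⟨q, hq, hpq⟩ := (Prime.dvd_finsetProd_iff hp.prime _).1 h
  rw [Finset.mem_inter] at hq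
  rw [(Nat.prime_dvd_prime_iff_eq hp (Nat.prime_of_mem_primeFactors hq.1)).1
    (hp.dvd_of_dvd_pow hpq)]
  exact hq.2

theorem dvd_primePart {n p : ℕ} {P : Finset ℕ} (hn : p ∈ n.primeFactors) (hP : p ∈ P) :
    p ∣ primePart n P :=
  (dvd_pow_self p (Nat.pos_iff_ne_zero.1 ((Nat.prime_of_mem_primeFactors hn).factorization_pos_of_dvd
    (Nat.mem_primeFactors.1 hn).2.2 (Nat.dvd_of_mem_primeFactors hn)))).trans
    (Finset.dvd_prod_of_mem (fun q => q ^ n.factorization q) (Finset.mem_inter.2 ⟨hn, hP⟩))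

theorem coprime_primePart {n p : ℕ} {P : Finset ℕ} (hp : p.Prime) (hP : p ∉ P) :
    p.Coprime (primePart n P) :=
  (hp.coprime_iff_not_dvd).2 fun h => hP (mem_of_prime_dvd_primePart hp h)

theorem ZMod.eq_zero_of_pow_nsmul_eq_zero {p k N : ℕ} (hN : p.Coprime N) {c : ZMod N}
    (hc : p ^ k • c = 0) : c = 0 := by
  have hunit : IsUnit ((p ^ k : ℕ) : ZMod N) :=
    (ZMod.isUnit_iff_coprime _ _).2 (hN.pow_left k)
  rw [nsmul_eq_mul] at hc
  exact hunit.mul_right_eq_zero.1 hc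

theorem ZMod.exists_ne_zero_nsmul_eq_zero {p N : ℕ} [NeZero N] (hp : p.Prime) (h : p ∣ N) :
    ∃ x : ZMod N, x ≠ 0 ∧ p • x = 0 := by
  have := Fact.mk hp
  obtain ⟨x, hx⟩ := exists_prime_addOrderOf_dvd_card' (G := ZMod N) p (by simpa using h)
  refine ⟨x, ?_, hx ▸ addOrderOf_nsmul_eq_zero x⟩
  rintro rfl
  rw [addOrderOf_zero] at hx
  exact hp.one_lt.ne hx

/-- A Sylow `p`-subgroup is cyclic when a homomorphism to a cyclic group detects the
vanishing of elements of `p`-power order. -/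
theorem Sylow.isCyclic_of_hom {G M : Type*} [AddGroup G] [AddGroup M] [IsAddCyclic M] {p : ℕ}
    (P : Sylow p (Multiplicative G)) (φ : G →+ M)
    (hφ : ∀ (k : ℕ) (x : G), p ^ k • x = 0 → φ x = 0 → x = 0) : IsCyclic P := by
  refine isCyclic_of_injective ((AddMonoidHom.toMultiplicative φ).comp P.toSubgroup.subtype)
    ((injective_iff_map_eq_one _).2 fun x hx => ?_)
  obtain ⟨k, hk⟩ := P.isPGroup' x
  exact Subtype.ext (hφ k (Multiplicative.toAdd (x : Multiplicative G)) (congrArg Subtype.val hk) hx)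

theorem IsCyclic.mem_zpowers_of_pow_prime_eq_one {H : Type*} [CommGroup H] [Finite H]
    [IsCyclic H] {p : ℕ} (hp : p.Prime) {a b : H} (ha : a ^ p = 1) (hb : b ^ p = 1)
    (hb1 : b ≠ 1) : a ∈ Subgroup.zpowers b := by
  have := Fact.mk hp
  have hle : Subgroup.zpowers b ≤ (powMonoidHom p : H →* H).ker := by
    rw [Subgroup.zpowers_le]
    exact hb
  have hcard : Nat.card (powMonoidHom p : H →* H).ker ≤ Nat.card (Subgroup.zpowers b) := by
    rw [IsCyclic.card_powMonoidHom_ker, Nat.card_zpowers, orderOf_eq_prime hb hb1]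
    exact Nat.gcd_le_right _ hp.pos
  rw [Subgroup.eq_of_le_of_card_ge hle hcard]
  exact ha

/-- Two elements of order `p`, separated by a homomorphism, prevent the Sylow `p`-subgroups
from being cyclic. -/
theorem Sylow.not_isCyclic_of_hom {G M : Type*} [AddCommGroup G] [Finite G] [AddGroup M] {p : ℕ}
    (hp : p.Prime) (P : Sylow p (Multiplicative G)) {a b : G} (ha : p • a = 0) (hb : p • b = 0)
    (hb0 : b ≠ 0) (φ : G →+ M) (hφa : φ a ≠ 0) (hφb : φ b = 0) : ¬ IsCyclic P := by
  intro hP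
  have := Fact.mk hp
  have hmem : ∀ x : G, p • x = 0 → Multiplicative.ofAdd x ∈ P := by
    intro x hx
    have hpg : IsPGroup p (Subgroup.zpowers (Multiplicative.ofAdd x)) := by
      refine IsPGroup.of_card_dvd_pow (n := 1) ?_
      rw [Nat.card_zpowers, pow_one]
      exact orderOf_dvd_of_pow_eq_one hx
    exact hpg.le_sylow_of_normal P (Subgroup.mem_zpowers _)
  obtain ⟨k, hk⟩ := IsCyclic.mem_zpowers_of_pow_prime_eq_one (H := P) hp
    (a := ⟨Multiplicative.ofAdd a, hmem a ha⟩) (b := ⟨Multiplicative.ofAdd b, hmem b hb⟩)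
    (Subtype.ext ha) (Subtype.ext hb) fun h => hb0 (congrArg Subtype.val h)
  have hk' : k • b = a := congrArg Subtype.val hk
  rw [← hk', map_zsmul, hφb, smul_zero] at hφa
  exact hφa rfl

/-- There is a prime `p ∈ A ∪ B` such that every Sylow `p`-subgroup of
`H₁ = ZMod n_A × ZMod n_C × ZMod m_B × ZMod m_D` is cyclic while no Sylow `p`-subgroup of
`H₂ = ZMod (n_A/m_A) × ZMod n_B × ZMod n_C × ZMod m_A × ZMod (m_B/n_B) × ZMod m_D` is. -/
theorem sylow_cyclic_H1_not_H2 (A B : Finset ℕ) (n m : ℕ) (h : Admissible A B n m) :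
    ∃ p ∈ A ∪ B, p.Prime ∧
      (∀ P : Sylow p (Multiplicative
          (ZMod (primePart n A) × ZMod (primePart n (n.primeFactors \ (A ∪ B))) ×
            ZMod (primePart m B) × ZMod (primePart m (m.primeFactors \ (A ∪ B))))),
        IsCyclic P) ∧
      (∀ P : Sylow p (Multiplicative
          (ZMod (primePart n A / primePart m A) × ZMod (primePart n B) ×
            ZMod (primePart n (n.primeFactors \ (A ∪ B))) × ZMod (primePart m A) ×
            ZMod (primePart m B / primePart n B) ×
            ZMod (primePart m (m.primeFactors \ (A ∪ B))))),
        ¬ IsCyclic P) := by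
  obtain ⟨-, -, hdisj, -, -, -, hsub, hdA, hdB, hlt⟩ := h
  rw [Nat.mul_div_mul_comm hdA hdB] at hlt
  have : NeZero (primePart n A / primePart m A) :=
    ⟨(Nat.div_pos (Nat.le_of_dvd (primePart_pos n A) hdA) (primePart_pos m A)).ne'⟩
  have : NeZero (primePart m B / primePart n B) :=
    ⟨(Nat.div_pos (Nat.le_of_dvd (primePart_pos m B) hdB) (primePart_pos n B)).ne'⟩
  obtain ⟨p, hp, hpd⟩ := Nat.exists_prime_and_dvd hlt.ne'
  have hcop (l : ℕ) (hl : p ∈ A ∪ B) :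
      p.Coprime (primePart l (l.primeFactors \ (A ∪ B))) :=
    coprime_primePart hp fun hmem => (Finset.mem_sdiff.1 hmem).2 hl
  rcases hp.dvd_mul.1 hpd with hpd | hpd
  · have hpA : p ∈ A :=
      mem_of_prime_dvd_primePart hp (hpd.trans (Nat.div_dvd_of_dvd hdA))
    have hpAB : p ∈ A ∪ B := Finset.mem_union_left _ hpA
    refine ⟨p, hpAB, hp, fun P => ?_, fun P => ?_⟩
    · refine P.isCyclic_of_hom (AddMonoidHom.fst _ _) ?_
      rintro k ⟨x, y, z, w⟩ hk rfl
      simp only [Prod.smul_mk, Prod.mk_eq_zero] at hk ⊢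
      exact ⟨trivial, ZMod.eq_zero_of_pow_nsmul_eq_zero (hcop n hpAB) hk.2.1,
        ZMod.eq_zero_of_pow_nsmul_eq_zero
          (coprime_primePart hp (Finset.disjoint_left.1 hdisj hpA)) hk.2.2.1,
        ZMod.eq_zero_of_pow_nsmul_eq_zero (hcop m hpAB) hk.2.2.2⟩
    · obtain ⟨x, hx0, hx⟩ := ZMod.exists_ne_zero_nsmul_eq_zero hp hpd
      obtain ⟨y, hy0, hy⟩ := ZMod.exists_ne_zero_nsmul_eq_zero hp
        (dvd_primePart (Finset.mem_inter.1 (hsub hpAB)).2 hpA)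
      exact P.not_isCyclic_of_hom hp (a := (x, 0, 0, 0, 0, 0)) (b := (0, 0, 0, y, 0, 0))
        (by simp only [Prod.smul_mk, hx, smul_zero, Prod.mk_zero_zero])
        (by simp only [Prod.smul_mk, hy, smul_zero, Prod.mk_zero_zero])
        (by simp [hy0]) (AddMonoidHom.fst _ _) hx0 rfl
  · have hpB : p ∈ B :=
      mem_of_prime_dvd_primePart hp (hpd.trans (Nat.div_dvd_of_dvd hdB))
    have hpAB : p ∈ A ∪ B := Finset.mem_union_right _ hpB
    refine ⟨p, hpAB, hp, fun P => ?_, fun P => ?_⟩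
    · refine P.isCyclic_of_hom ((AddMonoidHom.fst _ _).comp
        ((AddMonoidHom.snd _ _).comp (AddMonoidHom.snd _ _))) ?_
      rintro k ⟨x, y, z, w⟩ hk rfl
      simp only [Prod.smul_mk, Prod.mk_eq_zero] at hk ⊢
      exact ⟨ZMod.eq_zero_of_pow_nsmul_eq_zero
          (coprime_primePart hp (Finset.disjoint_right.1 hdisj hpB)) hk.1,
        ZMod.eq_zero_of_pow_nsmul_eq_zero (hcop n hpAB) hk.2.1, trivial,
        ZMod.eq_zero_of_pow_nsmul_eq_zero (hcop m hpAB) hk.2.2.2⟩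
    · obtain ⟨x, hx0, hx⟩ := ZMod.exists_ne_zero_nsmul_eq_zero hp hpd
      obtain ⟨y, hy0, hy⟩ := ZMod.exists_ne_zero_nsmul_eq_zero hp
        (dvd_primePart (Finset.mem_inter.1 (hsub hpAB)).1 hpB)
      exact P.not_isCyclic_of_hom hp (a := (0, y, 0, 0, 0, 0)) (b := (0, 0, 0, 0, x, 0))
        (by simp only [Prod.smul_mk, hy, smul_zero, Prod.mk_zero_zero])
        (by simp only [Prod.smul_mk, hx, smul_zero, Prod.mk_zero_zero])
        (by simp [hx0]) ((AddMonoidHom.fst _ _).comp (AddMonoidHom.snd _ _)) hy0 rfl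
end

section
/- Let A and B be disjoint finite sets of primes with A ∪ B ≠ ∅, and let (n,m) be admissible with respect to (A,B). Then there exist subgroups K₁ and K₂ of the abelian group G = ZMod n × ZMod m such that K₁ is isomorphic to H₁ = ZMod n_A × ZMod n_C × ZMod m_B × ZMod m_D, K₂ is isomorphic to H₂ = ZMod (n_A/m_A) × ZMod n_B × ZMod n_C × ZMod m_A × ZMod (m_B/n_B) × ZMod m_D, and both quotient groups G⧸K₁ and G⧸K₂ are isomorphic to the cyclic group ZMod (n_B·m_A). -/
/-- `G` is an extension of `Q` by `K`: there is a short exact sequence `0 → K → G → Q → 0`. -/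
def IsAddExtension (G K Q : Type*) [AddCommGroup G] [AddCommGroup K] [AddCommGroup Q] : Prop :=
  ∃ (i : K →+ G) (f : G →+ Q),
    Function.Injective i ∧ Function.Surjective f ∧ Function.Exact i f

namespace IsAddExtension

variable {G K Q G' K' Q' : Type*} [AddCommGroup G] [AddCommGroup K] [AddCommGroup Q]
  [AddCommGroup G'] [AddCommGroup K'] [AddCommGroup Q']

theorem exists_addSubgroup (h : IsAddExtension G K Q) :
    ∃ L : AddSubgroup G, Nonempty (L ≃+ K) ∧ Nonempty ((G ⧸ L) ≃+ Q) := by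
  obtain ⟨i, f, hi, hf, hif⟩ := h
  have hker : f.ker = i.range := by
    ext x
    exact hif x
  refine ⟨i.range, ⟨(AddMonoidHom.ofInjective hi).symm⟩, ⟨?_⟩⟩
  exact (QuotientAddGroup.quotientAddEquivOfEq hker.symm).trans
    (QuotientAddGroup.quotientKerEquivOfSurjective f hf)

theorem congr (h : IsAddExtension G K Q) (eG : G' ≃+ G) (eK : K' ≃+ K) (eQ : Q' ≃+ Q) :
    IsAddExtension G' K' Q' := by
  obtain ⟨i, f, hi, hf, hif⟩ := h
  refine ⟨(eG.symm.toAddMonoidHom.comp i).comp eK.toAddMonoidHom,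
    (eQ.symm.toAddMonoidHom.comp f).comp eG.toAddMonoidHom,
    (eG.symm.injective.comp hi).comp eK.injective,
    (eQ.symm.surjective.comp hf).comp eG.surjective, fun x => ?_⟩
  have hx : (∃ y, i y = eG x) ↔ ∃ y, i (eK y) = eG x := eK.surjective.exists
  change eQ.symm (f (eG x)) = 0 ↔ ∃ y, eG.symm (i (eK y)) = x
  simp only [EmbeddingLike.map_eq_zero_iff, AddEquiv.symm_apply_eq]
  exact (hif (eG x)).trans hx

theorem prod (h : IsAddExtension G K Q) (h' : IsAddExtension G' K' Q') :
    IsAddExtension (G × G') (K × K') (Q × Q') := by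
  obtain ⟨i, f, hi, hf, hif⟩ := h
  obtain ⟨i', f', hi', hf', hif'⟩ := h'
  refine ⟨i.prodMap i', f.prodMap f', hi.prodMap hi', hf.prodMap hf', ?_⟩
  rintro ⟨x, x'⟩
  have hx := hif x
  have hx' := hif' x'
  simp only [Set.mem_range] at hx hx'
  simp [hx, hx']

variable (K Q) in
theorem split : IsAddExtension (K × Q) K Q := by
  refine ⟨AddMonoidHom.inl K Q, AddMonoidHom.snd K Q, fun x y h => congrArg Prod.fst h,
    Prod.snd_surjective, ?_⟩
  rintro ⟨x, y⟩
  simp [eq_comm]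

theorem zmod_mul (d e : ℕ) [NeZero e] : IsAddExtension (ZMod (d * e)) (ZMod d) (ZMod e) := by
  have he : (e : ℤ) ≠ 0 := by exact_mod_cast NeZero.ne e
  let g : ℤ →+ ZMod (d * e) := zmultiplesHom _ (e : ZMod (d * e))
  have hg (k : ℤ) : g k = ((k * e : ℤ) : ZMod (d * e)) := by simp [g]
  refine ⟨ZMod.lift d ⟨g, ?_⟩, (ZMod.castHom (dvd_mul_left e d) (ZMod e)).toAddMonoidHom,
    ?_, ZMod.ringHom_surjective _, fun x => ?_⟩
  · rw [hg, ZMod.intCast_zmod_eq_zero_iff_dvd]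
    simp
  · refine (ZMod.lift_injective _).2 fun k hk => ?_
    replace hk : g k = 0 := hk
    rw [hg, ZMod.intCast_zmod_eq_zero_iff_dvd, Nat.cast_mul] at hk
    rw [ZMod.intCast_zmod_eq_zero_iff_dvd]
    exact Int.dvd_of_mul_dvd_mul_right he hk
  · obtain ⟨k, rfl⟩ := ZMod.intCast_surjective x
    have hk : ZMod.castHom (dvd_mul_left e d) (ZMod e) (k : ZMod (d * e)) = (k : ZMod e) :=
      map_intCast _ k
    change ZMod.castHom (dvd_mul_left e d) (ZMod e) (k : ZMod (d * e)) = 0 ↔ _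
    rw [hk, ZMod.intCast_zmod_eq_zero_iff_dvd]
    constructor
    · rintro ⟨t, rfl⟩
      refine ⟨(t : ZMod d), ?_⟩
      rw [ZMod.lift_coe]
      exact (hg t).trans (congrArg _ (mul_comm _ _))
    · rintro ⟨y, hy⟩
      obtain ⟨t, rfl⟩ := ZMod.intCast_surjective y
      rw [ZMod.lift_coe] at hy
      replace hy := (hg t).symm.trans hy
      rw [ZMod.intCast_eq_intCast_iff_dvd_sub, Nat.cast_mul] at hy
      have := (dvd_mul_left (e : ℤ) d).trans hy
      exact (dvd_sub_left (dvd_mul_left _ _)).1 this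

theorem zmod_of_dvd {a b : ℕ} (hab : b ∣ a) (hb : b ≠ 0) :
    IsAddExtension (ZMod a) (ZMod (a / b)) (ZMod b) := by
  have : NeZero b := ⟨hb⟩
  have h := zmod_mul (a / b) b
  rwa [Nat.div_mul_cancel hab] at h

end IsAddExtension

theorem coprime_primePart_s3 (n m : ℕ) {P Q : Finset ℕ} (h : Disjoint P Q) :
    (primePart n P).Coprime (primePart m Q) := by
  refine Nat.Coprime.prod_left fun p hp => Nat.Coprime.prod_right fun q hq => ?_
  rw [Finset.mem_inter] at hp hq
  exact Nat.Coprime.pow _ _ ((Nat.coprime_primes (Nat.prime_of_mem_primeFactors hp.1)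
    (Nat.prime_of_mem_primeFactors hq.1)).2 (Finset.disjoint_left.1 h hp.2 <| · ▸ hq.2))

theorem primePart_union (n : ℕ) {P Q : Finset ℕ} (h : Disjoint P Q) :
    primePart n (P ∪ Q) = primePart n P * primePart n Q := by
  rw [primePart, Finset.inter_union_distrib_left, Finset.prod_union]
  · rfl
  · exact h.mono Finset.inter_subset_right Finset.inter_subset_right

theorem primePart_of_primeFactors_subset {n : ℕ} (hn : n ≠ 0) {P : Finset ℕ}
    (h : n.primeFactors ⊆ P) : primePart n P = n := by
  rw [primePart, Finset.inter_eq_left.2 h]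
  exact Nat.prod_factorization_pow_eq_self hn

theorem nonempty_zmod_addEquiv_primePart {n : ℕ} (hn : n ≠ 0) {A B : Finset ℕ}
    (h : Disjoint A B) :
    Nonempty (ZMod n ≃+ (ZMod (primePart n A) × ZMod (primePart n B)) ×
      ZMod (primePart n (n.primeFactors \ (A ∪ B)))) := by
  have hd : Disjoint (A ∪ B) (n.primeFactors \ (A ∪ B)) := Finset.disjoint_sdiff
  have hmul : n = primePart n A * primePart n B * primePart n (n.primeFactors \ (A ∪ B)) := by
    rw [← primePart_union n h, ← primePart_union n hd, primePart_of_primeFactors_subset hn]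
    rw [Finset.union_sdiff_self_eq_union]
    exact Finset.subset_union_right
  have hc := coprime_primePart_s3 n n hd
  rw [primePart_union n h] at hc
  exact ⟨((ZMod.ringEquivCongr hmul).trans (ZMod.chineseRemainder hc)).toAddEquiv.trans
    ((ZMod.chineseRemainder (coprime_primePart_s3 n n h)).toAddEquiv.prodCongr (AddEquiv.refl _))⟩

/-- `G = ZMod n × ZMod m` contains subgroups `K₁ ≅ H₁` and `K₂ ≅ H₂` whose quotients
`G/K₁` and `G/K₂` are both isomorphic to the cyclic group `ZMod (n_B · m_A)`. -/
theorem exists_subgroups_iso_H1_H2 (A B : Finset ℕ) (n m : ℕ) (h : Admissible A B n m) :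
    ∃ K₁ K₂ : AddSubgroup (ZMod n × ZMod m),
      Nonempty (K₁ ≃+
        (ZMod (primePart n A) × ZMod (primePart n (n.primeFactors \ (A ∪ B))) ×
          ZMod (primePart m B) × ZMod (primePart m (m.primeFactors \ (A ∪ B))))) ∧
      Nonempty (K₂ ≃+
        (ZMod (primePart n A / primePart m A) × ZMod (primePart n B) ×
          ZMod (primePart n (n.primeFactors \ (A ∪ B))) × ZMod (primePart m A) ×
          ZMod (primePart m B / primePart n B) ×
          ZMod (primePart m (m.primeFactors \ (A ∪ B))))) ∧
      Nonempty (((ZMod n × ZMod m) ⧸ K₁) ≃+ ZMod (primePart n B * primePart m A)) ∧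
      Nonempty (((ZMod n × ZMod m) ⧸ K₂) ≃+ ZMod (primePart n B * primePart m A)) := by
  obtain ⟨-, -, hAB, -, hn, hm, -, hA, hB, -⟩ := h
  obtain ⟨en⟩ := nonempty_zmod_addEquiv_primePart (n := n) (by lia) hAB
  obtain ⟨em⟩ := nonempty_zmod_addEquiv_primePart (n := m) (by lia) hAB
  have eQ := (ZMod.chineseRemainder (coprime_primePart_s3 n m hAB.symm)).toAddEquiv
  have hA0 := primePart_ne_zero m A
  have hB0 := primePart_ne_zero n B
  generalize primePart n (n.primeFactors \ (A ∪ B)) = nC at *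
  generalize primePart m (m.primeFactors \ (A ∪ B)) = mD at *
  generalize primePart n A = nA at *
  generalize primePart n B = nB at *
  generalize primePart m A = mA at *
  generalize primePart m B = mB at *
  have h₁ : IsAddExtension (ZMod n × ZMod m)
      (ZMod nA × ZMod nC × ZMod mB × ZMod mD) (ZMod (nB * mA)) := by
    refine (IsAddExtension.split _ _).congr ((en.prodCongr em).trans ?_) (.refl _) eQ
    exact
      { toFun := fun x => ((x.1.1.1, x.1.2, x.2.1.2, x.2.2), x.1.1.2, x.2.1.1)
        invFun := fun y => (((y.1.1, y.2.1), y.1.2.1), (y.2.2, y.1.2.2.1), y.1.2.2.2)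
        map_add' := fun _ _ => rfl }
  have h₂ : IsAddExtension (ZMod n × ZMod m)
      (ZMod (nA / mA) × ZMod nB × ZMod nC × ZMod mA × ZMod (mB / nB) × ZMod mD)
      (ZMod (nB * mA)) := by
    refine (((IsAddExtension.zmod_of_dvd hB hB0).prod (IsAddExtension.zmod_of_dvd hA hA0)).prod
      (IsAddExtension.split (ZMod nB × ZMod nC × ZMod mA × ZMod mD) PUnit.{1})).congr
      ((en.prodCongr em).trans ?_) ?_ (eQ.trans AddEquiv.prodUnique.symm)
    · exact
        { toFun := fun x =>
            ((x.2.1.2, x.1.1.1), (x.1.1.2, x.1.2, x.2.1.1, x.2.2), PUnit.unit)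
          invFun := fun y =>
            (((y.1.2, y.2.1.1), y.2.1.2.1), (y.2.1.2.2.1, y.1.1), y.2.1.2.2.2)
          map_add' := fun _ _ => rfl }
    · exact
        { toFun := fun x =>
            ((x.2.2.2.2.1, x.1), (x.2.1, x.2.2.1, x.2.2.2.1, x.2.2.2.2.2))
          invFun := fun y =>
            (y.1.2, y.2.1, y.2.2.1, y.2.2.2.1, y.1.1, y.2.2.2.2)
          map_add' := fun _ _ => rfl }
  obtain ⟨K₁, e₁, q₁⟩ := h₁.exists_addSubgroup
  obtain ⟨K₂, e₂, q₂⟩ := h₂.exists_addSubgroup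
  exact ⟨K₁, K₂, e₁, e₂, q₁, q₂⟩
end

section
/- Let n, m ≥ 2 be integers and set d = gcd(n,m). If d > 1 and at least one of gcd(d, n/d) and gcd(d, m/d) is different from 1, then there exist disjoint finite sets of primes A and B with A ∪ B ≠ ∅ such that the pair (n,m) is admissible with respect to (A,B). -/
theorem primePart_empty (n : ℕ) : primePart n ∅ = 1 := by
  simp [primePart]

theorem primePart_singleton {n p : ℕ} (hp : p ∈ n.primeFactors) :
    primePart n {p} = p ^ n.factorization p := by
  rw [primePart, Finset.inter_singleton_of_mem hp, Finset.prod_singleton]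

theorem exists_prime_factorization_lt {a b : ℕ} (ha : a ≠ 0) (hb : b ≠ 0)
    (h : Nat.gcd (Nat.gcd a b) (a / Nat.gcd a b) ≠ 1) :
    ∃ p, p.Prime ∧ p ∈ a.primeFactors ∧ p ∈ b.primeFactors ∧
      b.factorization p < a.factorization p := by
  obtain ⟨p, hp, hpd, hpq⟩ := Nat.Prime.not_coprime_iff_dvd.mp h
  have hpa : p ∣ a := hpd.trans (Nat.gcd_dvd_left a b)
  have hpb : p ∣ b := hpd.trans (Nat.gcd_dvd_right a b)
  refine ⟨p, hp, Nat.mem_primeFactors.mpr ⟨hp, hpa, ha⟩,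
    Nat.mem_primeFactors.mpr ⟨hp, hpb, hb⟩, ?_⟩
  by_contra! hle
  have hdvd : p ^ a.factorization p ∣ Nat.gcd a b :=
    Nat.dvd_gcd (Nat.ordProj_dvd a p) ((hp.pow_dvd_iff_le_factorization hb).mpr hle)
  have hsucc : p ^ (a.factorization p + 1) ∣ a := by
    simpa only [pow_succ, Nat.mul_div_cancel' (Nat.gcd_dvd_left a b)] using mul_dvd_mul hdvd hpq
  exact Nat.pow_succ_factorization_not_dvd ha hp hsucc

theorem one_lt_pow_div_pow {p k l : ℕ} (hp : p.Prime) (h : k < l) : 1 < p ^ l / p ^ k := by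
  rw [Nat.pow_div h.le hp.pos]
  exact Nat.one_lt_pow (Nat.sub_ne_zero_of_lt h) hp.one_lt

/-- If `d = gcd(n,m) > 1` and at least one of `gcd(d, n/d)` and `gcd(d, m/d)` is not `1`,
then `(n, m)` is admissible with respect to some pair `(A, B)`. -/
theorem exists_admissible_of_gcd (n m : ℕ) (hn : 2 ≤ n) (hm : 2 ≤ m)
    (hd : 1 < Nat.gcd n m)
    (h : Nat.gcd (Nat.gcd n m) (n / Nat.gcd n m) ≠ 1 ∨
         Nat.gcd (Nat.gcd n m) (m / Nat.gcd n m) ≠ 1) :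
    ∃ A B : Finset ℕ, Admissible A B n m := by
  have hn0 : n ≠ 0 := by lia
  have hm0 : m ≠ 0 := by lia
  rcases h with h | h
  · obtain ⟨p, hp, hpn, hpm, hlt⟩ := exists_prime_factorization_lt hn0 hm0 h
    refine ⟨{p}, ∅, by simpa using hp, by simp, by simp, by simp, hn, hm, ?_, ?_, ?_, ?_⟩
    · simpa only [Finset.union_empty, Finset.singleton_subset_iff, Finset.mem_inter]
        using ⟨hpn, hpm⟩
    · rw [primePart_singleton hpn, primePart_singleton hpm]
      exact pow_dvd_pow p hlt.le
    · simp only [primePart_empty, dvd_refl]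
    · simpa only [primePart_empty, primePart_singleton hpn, primePart_singleton hpm, mul_one]
        using one_lt_pow_div_pow hp hlt
  · rw [Nat.gcd_comm n m] at h
    obtain ⟨p, hp, hpm, hpn, hlt⟩ := exists_prime_factorization_lt hm0 hn0 h
    refine ⟨∅, {p}, by simp, by simpa using hp, by simp, by simp, hn, hm, ?_, ?_, ?_, ?_⟩
    · simpa only [Finset.empty_union, Finset.singleton_subset_iff, Finset.mem_inter]
        using ⟨hpn, hpm⟩
    · simp only [primePart_empty, dvd_refl]
    · rw [primePart_singleton hpn, primePart_singleton hpm]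
      exact pow_dvd_pow p hlt.le
    · simpa only [primePart_empty, primePart_singleton hpn, primePart_singleton hpm, one_mul]
        using one_lt_pow_div_pow hp hlt
end

section
/- Let G be a finitely generated group, let f be an automorphism of G, and let H₁, …, H_r be finitely many subgroups of G, each of finite index in G. Then there exists an integer k ≥ 1 such that the k-th power of f maps each subgroup H_i onto itself, i.e. f^k(H_i) = H_i for all i = 1, …, r. -/
theorem Group.FG.finite_monoidHom (G M : Type*) [Group G] [Group.FG G] [Group M] [Finite M] :
    Finite (G →* M) := by
  obtain ⟨S, hS⟩ := Group.FG.out (G := G)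
  refine Finite.of_injective (fun (φ : G →* M) (s : S) ↦ φ s) fun φ ψ h ↦ ?_
  exact MonoidHom.eq_of_eqOn_dense hS fun s hs ↦ congrFun h ⟨s, hs⟩

/-- A finitely generated group has finitely many subgroups of a given nonzero index. -/
theorem Subgroup.finite_setOf_index_eq (G : Type*) [Group G] [Group.FG G] {n : ℕ} (hn : n ≠ 0) :
    {K : Subgroup G | K.index = n}.Finite := by
  have := Group.FG.finite_monoidHom G (Equiv.Perm (Fin n))
  refine (Set.finite_range fun p : (G →* Equiv.Perm (Fin n)) × Fin n ↦
    (MulAction.stabilizer (Equiv.Perm (Fin n)) p.2).comap p.1).subset fun K hK ↦ ?_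
  have : Finite (G ⧸ K) := Nat.finite_of_card_ne_zero (by rwa [← hK] at hn)
  let e : G ⧸ K ≃ Fin n := Finite.equivFinOfCardEq hK
  refine ⟨(e.permCongrHom.toMonoidHom.comp (MulAction.toPermHom G (G ⧸ K)), e (1 : G)), ?_⟩
  ext g
  simp [MulAction.mem_stabilizer_iff, Equiv.permCongrHom, Equiv.permCongr_apply,
    MulAction.Quotient.smul_mk, QuotientGroup.eq]


/-- If `G` is a finitely generated group, `f` an automorphism of `G` and `H₁, …, H_r`
finitely many finite-index subgroups of `G`, then some power `f^k`, `k ≥ 1`, maps each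
`H_i` onto itself. -/
theorem exists_pow_map_subgroups_eq (G : Type*) [Group G] [Group.FG G] (f : MulAut G)
    (r : ℕ) (H : Fin r → Subgroup G) (hH : ∀ i, (H i).index ≠ 0) :
    ∃ k : ℕ, 1 ≤ k ∧ ∀ i : Fin r, (H i).map (f ^ k).toMonoidHom = H i := by
  obtain ⟨a, b, hab, h⟩ := Set.Finite.exists_lt_map_eq_of_forall_mem
    (f := fun (k : ℕ) (i : Fin r) ↦ (H i).map (f ^ k).toMonoidHom)
    (t := {K | ∀ i, K i ∈ {L : Subgroup G | L.index = (H i).index}})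
    (fun k i ↦ Subgroup.index_map_equiv (H i) (f ^ k))
    (Set.Finite.pi' fun i ↦ Subgroup.finite_setOf_index_eq G (hH i))
  refine ⟨b - a, by omega, fun i ↦
    Subgroup.map_injective (f := (f ^ a).toMonoidHom) (f ^ a).injective ?_⟩
  have hpow : f ^ b = f ^ a * f ^ (b - a) := by rw [← pow_add, Nat.add_sub_cancel' hab.le]
  have h := congrFun h i
  simp only [hpow] at h
  exact (Subgroup.map_map (H i) _ _).trans h.symm
end

section
/- Let G be a finitely generated group, let N be a normal subgroup of G of finite index, and let f be an automorphism of G. Then there exists an integer k ≥ 1 such that f^k(g)·g⁻¹ ∈ N for every g ∈ G; consequently, this power f^k maps every subgroup K of G with N ≤ K onto itself, i.e. f^k(K) = K for all subgroups K containing N. -/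
/-- There are only finitely many homomorphisms from a finitely generated group to a finite
monoid. -/
theorem MonoidHom.finite_of_group_fg (G M : Type*) [Group G] [Group.FG G] [Monoid M] [Finite M] :
    Finite (G →* M) := by
  obtain ⟨S, hS⟩ := Group.FG.out (G := G)
  refine Finite.of_injective (fun (φ : G →* M) (s : S) => φ s) fun φ ψ h => ?_
  exact MonoidHom.eq_of_eqOn_dense hS fun s hs => congrFun h ⟨s, hs⟩

/-- For a homomorphism `φ` from a finitely generated group to a finite monoid, some
positive power of any automorphism of the source leaves `φ` unchanged. -/
theorem MulAut.exists_pow_comp_eq {G M : Type*} [Group G] [Group.FG G] [Monoid M] [Finite M]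
    (φ : G →* M) (f : MulAut G) : ∃ k : ℕ, 1 ≤ k ∧ ∀ g, φ ((f ^ k) g) = φ g := by
  have := MonoidHom.finite_of_group_fg G M
  obtain ⟨m, n, hmn, h⟩ := Finite.exists_ne_map_eq_of_infinite
    fun n : ℕ => φ.comp (f ^ n).toMonoidHom
  wlog hlt : m < n generalizing m n
  · exact this n m hmn.symm h.symm (by lia)
  refine ⟨n - m, by lia, fun g => ?_⟩
  obtain ⟨x, rfl⟩ := (f ^ m).surjective g
  rw [← MulAut.mul_apply, ← pow_add, Nat.sub_add_cancel hlt.le]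
  exact (DFunLike.congr_fun h x).symm

/-- An automorphism that is the identity modulo `N` preserves every subgroup containing `N`. -/
theorem Subgroup.map_mulAut_eq_of_mul_inv_mem {G : Type*} [Group G] {N K : Subgroup G}
    {f : MulAut G} (hf : ∀ g, f g * g⁻¹ ∈ N) (hK : N ≤ K) : K.map f.toMonoidHom = K := by
  have mem_iff (g : G) : f g ∈ K ↔ g ∈ K := by
    rw [← K.mul_mem_cancel_left (hK (hf g)) (y := g), inv_mul_cancel_right]
  ext g
  obtain ⟨x, rfl⟩ := f.surjective g
  rw [mem_iff]
  exact Subgroup.mem_map_iff_mem f.injective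

/-- If `G` is a finitely generated group, `N` a finite-index normal subgroup and `f` an
automorphism of `G`, then some power `f^k`, `k ≥ 1`, induces the identity on `G/N`
(i.e. `f^k(g)·g⁻¹ ∈ N` for all `g`); consequently this power maps every subgroup `K`
with `N ≤ K` onto itself. -/
theorem exists_pow_id_mod_normal (G : Type*) [Group G] [Group.FG G] (N : Subgroup G)
    [N.Normal] (hN : N.index ≠ 0) (f : MulAut G) :
    ∃ k : ℕ, 1 ≤ k ∧ (∀ g : G, (f ^ k) g * g⁻¹ ∈ N) ∧
      ∀ K : Subgroup G, N ≤ K → K.map (f ^ k).toMonoidHom = K := by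
  have : N.FiniteIndex := ⟨hN⟩
  obtain ⟨k, hk, h⟩ := MulAut.exists_pow_comp_eq (QuotientGroup.mk' N) f
  have hf (g : G) : (f ^ k) g * g⁻¹ ∈ N := by
    rw [← QuotientGroup.eq_one_iff, QuotientGroup.mk_mul, QuotientGroup.mk_inv, mul_inv_eq_one]
    exact h g
  exact ⟨k, hk, hf, fun K hK => Subgroup.map_mulAut_eq_of_mul_inv_mem hf hK⟩
end

section
/- There exists an infinite set S of matrices in SL(2,ℤ), each of trace strictly greater than 2, such that for any two distinct matrices A, B ∈ S and any integers k, l ≥ 1, the matrices Aᵏ and Bˡ (viewed as matrices over ℚ) are not conjugate in GL(2,ℚ); that is, there is no invertible 2×2 rational matrix P with P·Aᵏ·P⁻¹ = Bˡ. -/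
theorem discr_conj_of_isUnit {P M : Matrix (Fin 2) (Fin 2) ℚ} (hP : IsUnit P) :
    (P * M * P⁻¹).discr = M.discr := by
  obtain ⟨g, rfl⟩ := hP
  simp

theorem discr_smul_add_smul_one (M : Matrix (Fin 2) (Fin 2) ℚ) (u v : ℚ) :
    (u • M + v • 1).discr = u ^ 2 * M.discr := by
  simp [Matrix.discr_fin_two, Matrix.trace_fin_two, Matrix.det_fin_two]
  ring

theorem pow_eq_smul_add_smul_one {M : Matrix (Fin 2) (Fin 2) ℚ} (hdet : M.det = 1)
    (htr : 2 < M.trace) (k : ℕ) :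
    ∃ u v : ℚ, 0 < u ∧ 0 ≤ u + v ∧ M ^ (k + 1) = u • M + v • 1 := by
  induction k with
  | zero => exact ⟨1, 0, by simp⟩
  | succ k ih =>
    obtain ⟨u, v, hu, huv, h⟩ := ih
    have hsq : M * M = M.trace • M - 1 := by
      have h1 := hdet
      rw [Matrix.det_fin_two] at h1
      ext i j
      fin_cases i <;> fin_cases j <;>
        simp [Matrix.mul_apply, Matrix.trace_fin_two] <;> linarith
    refine ⟨M.trace * u + v, -u, by nlinarith, by nlinarith, ?_⟩
    rw [pow_succ, h, add_mul, smul_mul_assoc, smul_mul_assoc, hsq, one_mul]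
    module

theorem exists_discr_pow_eq {M : Matrix (Fin 2) (Fin 2) ℚ} (hdet : M.det = 1)
    (htr : 2 < M.trace) {k : ℕ} (hk : 1 ≤ k) :
    ∃ u : ℚ, 0 < u ∧ (M ^ k).discr = u ^ 2 * M.discr := by
  obtain ⟨k, rfl⟩ := Nat.exists_eq_add_of_le' hk
  obtain ⟨u, v, hu, -, h⟩ := pow_eq_smul_add_smul_one hdet htr k
  exact ⟨u, hu, by rw [h, discr_smul_add_smul_one]⟩

theorem isSquare_discr_mul_of_conj_pow {M N P : Matrix (Fin 2) (Fin 2) ℚ}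
    (hM : M.det = 1) (hN : N.det = 1) (hMtr : 2 < M.trace) (hNtr : 2 < N.trace)
    {k l : ℕ} (hk : 1 ≤ k) (hl : 1 ≤ l) (hP : IsUnit P) (h : P * M ^ k * P⁻¹ = N ^ l) :
    IsSquare (M.discr * N.discr) := by
  obtain ⟨u, hu, hu'⟩ := exists_discr_pow_eq hM hMtr hk
  obtain ⟨w, -, hw⟩ := exists_discr_pow_eq hN hNtr hl
  rw [← h, discr_conj_of_isUnit hP, hu'] at hw
  refine ⟨w * N.discr / u, ?_⟩
  field_simp
  linear_combination N.discr * hw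

theorem not_isSquare_of_primes_modEq_one {p q : ℕ} (hp : p.Prime) (hq : q.Prime)
    (hp8 : p ≡ 1 [MOD 8]) (hq8 : q ≡ 1 [MOD 8]) (hlt : p < q) :
    ¬ IsSquare (p * (p + 4) * (q * (q + 4))) := by
  rintro ⟨r, hr⟩
  unfold Nat.ModEq at hp8 hq8
  have hp1 := hp.two_le
  have hqr : q ∣ r := by
    have : q ∣ r * r := ⟨p * (p + 4) * (q + 4), by rw [← hr]; ring⟩
    exact (hq.dvd_mul.1 this).elim id id
  obtain ⟨s, rfl⟩ := hqr
  have h : q ∣ p * (p + 4) * (q + 4) :=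
    ⟨s * s, Nat.eq_of_mul_eq_mul_left hq.pos (by linear_combination hr)⟩
  rcases hq.dvd_mul.1 h with h | h
  · rcases hq.dvd_mul.1 h with h | h
    · exact absurd (Nat.le_of_dvd hp.pos h) (by omega)
    · have hle := Nat.le_of_dvd (by omega) h
      have := Nat.eq_zero_of_dvd_of_lt (Nat.dvd_sub h (dvd_refl q)) (by omega)
      omega
  · have := Nat.le_of_dvd (by norm_num) ((Nat.dvd_add_right (dvd_refl q)).1 h)
    omega

/-- The companion matrix of `X² - (p + 2) X + 1`. -/
def companionSL (p : ℕ) : Matrix.SpecialLinearGroup (Fin 2) ℤ :=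
  ⟨!![(p : ℤ) + 2, -1; 1, 0], by simp [Matrix.det_fin_two]⟩

theorem trace_companionSL (p : ℕ) :
    Matrix.trace (companionSL p : Matrix (Fin 2) (Fin 2) ℤ) = p + 2 := by
  simp [companionSL, Matrix.trace_fin_two]

theorem companionSL_injective : Function.Injective companionSL := fun p q h => by
  have := congrArg (fun A : Matrix.SpecialLinearGroup (Fin 2) ℤ =>
    Matrix.trace (A : Matrix (Fin 2) (Fin 2) ℤ)) h
  simpa [trace_companionSL] using this

theorem trace_map_companionSL (p : ℕ) :
    ((companionSL p : Matrix (Fin 2) (Fin 2) ℤ).map ((↑) : ℤ → ℚ)).trace = p + 2 := by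
  simp [companionSL, Matrix.trace_fin_two]

theorem det_map_companionSL (p : ℕ) :
    ((companionSL p : Matrix (Fin 2) (Fin 2) ℤ).map ((↑) : ℤ → ℚ)).det = 1 := by
  simp [companionSL, Matrix.det_fin_two]

theorem discr_map_companionSL (p : ℕ) :
    ((companionSL p : Matrix (Fin 2) (Fin 2) ℤ).map ((↑) : ℤ → ℚ)).discr =
      ((p * (p + 4) : ℕ) : ℚ) := by
  rw [Matrix.discr_fin_two, trace_map_companionSL, det_map_companionSL]
  push_cast
  ring

/-- There are infinitely many matrices in `SL(2,ℤ)` of trace `> 2` (hence Anosov), no two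
distinct ones of which have powers `Aᵏ`, `Bˡ` (`k, l ≥ 1`) that are conjugate by an
invertible rational `2×2` matrix. -/
theorem infinite_nonconjugate_anosov :
    ∃ S : Set (Matrix.SpecialLinearGroup (Fin 2) ℤ), S.Infinite ∧
      (∀ A ∈ S, 2 < Matrix.trace (A : Matrix (Fin 2) (Fin 2) ℤ)) ∧
      ∀ A ∈ S, ∀ B ∈ S, A ≠ B → ∀ k l : ℕ, 1 ≤ k → 1 ≤ l →
        ¬ ∃ P : Matrix (Fin 2) (Fin 2) ℚ, IsUnit P ∧
          P * ((A : Matrix (Fin 2) (Fin 2) ℤ).map ((↑) : ℤ → ℚ)) ^ k * P⁻¹ =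
            ((B : Matrix (Fin 2) (Fin 2) ℤ).map ((↑) : ℤ → ℚ)) ^ l := by
  refine ⟨companionSL '' {p | p.Prime ∧ p ≡ 1 [MOD 8]},
    (Nat.infinite_setOfPred_prime_modEq_one (by norm_num)).image
      companionSL_injective.injOn, ?_, ?_⟩
  · rintro _ ⟨p, ⟨hp, -⟩, rfl⟩
    rw [trace_companionSL]
    have := hp.pos
    omega
  · rintro _ ⟨p, ⟨hp, hp8⟩, rfl⟩ _ ⟨q, ⟨hq, hq8⟩, rfl⟩ hne k l hk hl ⟨P, hP, h⟩
    have htr {n : ℕ} (hn : n.Prime) :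
        2 < ((companionSL n : Matrix (Fin 2) (Fin 2) ℤ).map ((↑) : ℤ → ℚ)).trace := by
      have : (0 : ℚ) < n := by exact_mod_cast hn.pos
      rw [trace_map_companionSL]
      linarith
    have hsq := isSquare_discr_mul_of_conj_pow (det_map_companionSL p)
      (det_map_companionSL q) (htr hp) (htr hq) hk hl hP h
    rw [discr_map_companionSL, discr_map_companionSL, ← Nat.cast_mul,
      Rat.isSquare_natCast_iff] at hsq
    rcases lt_trichotomy p q with hpq | rfl | hpq
    · exact not_isSquare_of_primes_modEq_one hp hq hp8 hq8 hpq hsq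
    · exact hne rfl
    · rw [mul_comm] at hsq
      exact not_isSquare_of_primes_modEq_one hq hp hq8 hp8 hpq hsq
end
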